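/- For every weighted graph G = (V,E) with edge weights w : E → ℝ≥0 and every vertex-stabilizer S ⊆ V of G, one has |S| ≥ γ(G). -/

import Mathlib

namespace Stabilizer

variable {V : Type*} [Fintype V] [DecidableEq V]

/-- The set of vertices covered by a finite set of edges. -/
def edgeVerts (C : Finset (Sym2 V)) : Set V := {v | ∃ e ∈ C, v ∈ e}

/-- A matching of `G`, given as a finite set of pairwise vertex-disjoint edges. -/
def IsMatching (G : SimpleGraph V) (M : Finset (Sym2 V)) : Prop :=
  (↑M ⊆ G.edgeSet) ∧ ∀ e ∈ M, ∀ f ∈ M, e ≠ f → ∀ v : V, v ∈ e → v ∉ f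

/-- The total weight of a finite set of edges. -/
noncomputable def setWeight (w : Sym2 V → ℝ) (M : Finset (Sym2 V)) : ℝ := ∑ e ∈ M, w e

/-- ν(G): the maximum weight of a matching of `G`. -/
noncomputable def nu (G : SimpleGraph V) (w : Sym2 V → ℝ) : ℝ :=
  sSup {r : ℝ | ∃ M : Finset (Sym2 V), IsMatching G M ∧ r = setWeight w M}

/-- A fractional matching of `G`. -/
def IsFracMatching (G : SimpleGraph V) (x : Sym2 V → ℝ) : Prop :=
  (∀ e, 0 ≤ x e) ∧ (∀ e, e ∉ G.edgeSet → x e = 0) ∧ ∀ v : V, ∑ u : V, x s(v, u) ≤ 1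

/-- The weight of a fractional matching. -/
noncomputable def fracWeight (w x : Sym2 V → ℝ) : ℝ := ∑ e : Sym2 V, w e * x e

/-- ν_f(G): the maximum weight of a fractional matching of `G`. -/
noncomputable def nuf (G : SimpleGraph V) (w : Sym2 V → ℝ) : ℝ :=
  sSup {r : ℝ | ∃ x : Sym2 V → ℝ, IsFracMatching G x ∧ r = fracWeight w x}

/-- A maximum-weight fractional matching of `G`. -/
def IsMaxFracMatching (G : SimpleGraph V) (w x : Sym2 V → ℝ) : Prop :=
  IsFracMatching G x ∧ ∀ y : Sym2 V → ℝ, IsFracMatching G y → fracWeight w y ≤ fracWeight w x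

/-- All entries lie in {0, 1/2, 1}. -/
def IsHalfIntegral (x : Sym2 V → ℝ) : Prop := ∀ e, x e = 0 ∨ x e = 1 / 2 ∨ x e = 1

/-- `C` is the edge set of an odd cycle of `G`. -/
def IsOddCycleEdgeSet (G : SimpleGraph V) (C : Finset (Sym2 V)) : Prop :=
  ∃ (v : V) (c : G.Walk v v), c.IsCycle ∧ Odd c.length ∧ c.edges.toFinset = C

/-- `F` is the family 𝒞(x) of vertex-disjoint odd cycles carrying exactly the
half-valued edges of `x`. -/
def IsCycleFamily (G : SimpleGraph V) (x : Sym2 V → ℝ) (F : Finset (Finset (Sym2 V))) : Prop :=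
  (∀ C ∈ F, IsOddCycleEdgeSet G C) ∧
  (∀ C ∈ F, ∀ D ∈ F, C ≠ D → Disjoint (edgeVerts C) (edgeVerts D)) ∧
  (∀ e : Sym2 V, x e = 1 / 2 ↔ ∃ C ∈ F, e ∈ C)

/-- A basic fractional matching of `G`. -/
def IsBasic (G : SimpleGraph V) (x : Sym2 V → ℝ) : Prop :=
  IsFracMatching G x ∧ IsHalfIntegral x ∧ ∃ F, IsCycleFamily G x F

/-- γ(G): the minimum number of odd cycles in the support of a basic
maximum-weight fractional matching of `G`. -/
noncomputable def gamma (G : SimpleGraph V) (w : Sym2 V → ℝ) : ℕ :=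
  sInf {n : ℕ | ∃ (x : Sym2 V → ℝ) (F : Finset (Finset (Sym2 V))),
    IsMaxFracMatching G w x ∧ IsHalfIntegral x ∧ IsCycleFamily G x F ∧ F.card = n}

/-- `G` is stable: ν(G) = ν_f(G). -/
def IsStable (G : SimpleGraph V) (w : Sym2 V → ℝ) : Prop := nu G w = nuf G w

/-- Deletion of a set of vertices (as the spanning subgraph obtained by
removing all edges incident to `S`; matchings, fractional matchings and covers
of `G∖S` correspond to those of this graph). -/
def deleteVerts (G : SimpleGraph V) (S : Set V) : SimpleGraph V where
  Adj a b := G.Adj a b ∧ a ∉ S ∧ b ∉ S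
  symm := ⟨fun _ _ h => ⟨h.1.symm, h.2.2, h.2.1⟩⟩
  loopless := ⟨fun a h => G.loopless.irrefl a h.1⟩

/-- A fractional w-vertex cover of `G`. -/
def IsFracCover (G : SimpleGraph V) (w : Sym2 V → ℝ) (y : V → ℝ) : Prop :=
  (∀ v, 0 ≤ y v) ∧ ∀ a b : V, G.Adj a b → w s(a, b) ≤ y a + y b

noncomputable def coverValue (y : V → ℝ) : ℝ := ∑ v : V, y v

/-- A minimum fractional w-vertex cover of `G`. -/
def IsMinFracCover (G : SimpleGraph V) (w : Sym2 V → ℝ) (y : V → ℝ) : Prop :=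
  IsFracCover G w y ∧ ∀ z : V → ℝ, IsFracCover G w z → coverValue y ≤ coverValue z

/-- M(x): the 1-valued edges of `x`. -/
noncomputable def oneEdges (x : Sym2 V → ℝ) : Finset (Sym2 V) :=
  Finset.univ.filter fun e => x e = 1

/-- `v` is exposed by the matching `M`. -/
def MExposed (M : Finset (Sym2 V)) (v : V) : Prop := ∀ e ∈ M, v ∉ e

/-- A list of edges alternately in and out of `M`. -/
def AltList (M : Finset (Sym2 V)) (l : List (Sym2 V)) : Prop :=
  l.Chain' fun e f => (e ∈ M ↔ f ∉ M)

variable {G : SimpleGraph V}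

/-- An M-alternating walk. -/
def IsAltWalk (M : Finset (Sym2 V)) {a b : V} (p : G.Walk a b) : Prop := AltList M p.edges

/-- A valid walk: it starts (resp. ends) with an M-exposed vertex or an edge of `M`. -/
def IsValidWalk (M : Finset (Sym2 V)) {a b : V} (p : G.Walk a b) : Prop :=
  (MExposed M a ∨ ∃ e ∈ M, p.edges.head? = some e) ∧
  (MExposed M b ∨ ∃ e ∈ M, p.edges.getLast? = some e)

/-- w(P ∩ M), with multiplicity. -/
noncomputable def wIn (w : Sym2 V → ℝ) (M : Finset (Sym2 V)) (l : List (Sym2 V)) : ℝ :=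
  (l.map fun e => if e ∈ M then w e else 0).sum

/-- w(P ∖ M), with multiplicity. -/
noncomputable def wOut (w : Sym2 V → ℝ) (M : Finset (Sym2 V)) (l : List (Sym2 V)) : ℝ :=
  (l.map fun e => if e ∈ M then 0 else w e).sum

/-- An M-augmenting walk. -/
def IsAugWalk (w : Sym2 V → ℝ) (M : Finset (Sym2 V)) {a b : V} (p : G.Walk a b) : Prop :=
  IsAltWalk M p ∧ IsValidWalk M p ∧ wIn w M p.edges < wOut w M p.edges

/-- An M-augmenting path. -/
def IsAugPath (w : Sym2 V → ℝ) (M : Finset (Sym2 V)) {a b : V} (p : G.Walk a b) : Prop :=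
  p.IsPath ∧ IsAugWalk w M p

/-- An M-alternating cycle (an even cycle alternately in and out of `M`). -/
def IsAltCycle (M : Finset (Sym2 V)) {a : V} (c : G.Walk a a) : Prop :=
  c.IsCycle ∧ Even c.length ∧ AltList M c.edges ∧
  ∀ e f : Sym2 V, c.edges.head? = some e → c.edges.getLast? = some f → (e ∈ M ↔ f ∉ M)

/-- An M-augmenting cycle. -/
def IsAugCycle (w : Sym2 V → ℝ) (M : Finset (Sym2 V)) {a : V} (c : G.Walk a a) : Prop :=
  IsAltCycle M c ∧ wIn w M c.edges < wOut w M c.edges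

/-- An M-blossom with base `a` (traversed starting and ending at its base). -/
def IsBlossom (M : Finset (Sym2 V)) {a : V} (c : G.Walk a a) : Prop :=
  c.IsCycle ∧ Odd c.length ∧ AltList M c.edges ∧
  ∀ e : Sym2 V, c.edges.head? = some e → e ∉ M

/-- An M-flower: an M-blossom `c` with base `a` together with a valid M-alternating
path `p` from the base `a` to the root `r`, starting with an edge of `M`. -/
def IsFlower (M : Finset (Sym2 V)) {a r : V} (c : G.Walk a a) (p : G.Walk a r) : Prop :=
  IsBlossom M c ∧ p.IsPath ∧ AltList M p.edges ∧
  (∃ e ∈ M, p.edges.head? = some e) ∧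
  (MExposed M r ∨ ∃ e ∈ M, p.edges.getLast? = some e)

/-- An M-augmenting flower (with root `r`). -/
def IsAugFlower (w : Sym2 V → ℝ) (M : Finset (Sym2 V)) {a r : V}
    (c : G.Walk a a) (p : G.Walk a r) : Prop :=
  IsFlower M c p ∧
  wIn w M c.edges + 2 * wIn w M p.edges < wOut w M c.edges + 2 * wOut w M p.edges

/-- An M-bi-cycle: two M-blossoms `c`, `d` with bases `a`, `b` joined by an odd
M-alternating path `p` starting and ending with edges of `M`. -/
def IsBicycle (M : Finset (Sym2 V)) {a b : V}
    (c : G.Walk a a) (p : G.Walk a b) (d : G.Walk b b) : Prop :=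
  IsBlossom M c ∧ IsBlossom M d ∧ p.IsPath ∧ Odd p.length ∧ AltList M p.edges ∧
  (∃ e ∈ M, p.edges.head? = some e) ∧ (∃ e ∈ M, p.edges.getLast? = some e)

/-- An M-augmenting bi-cycle. -/
def IsAugBicycle (w : Sym2 V → ℝ) (M : Finset (Sym2 V)) {a b : V}
    (c : G.Walk a a) (p : G.Walk a b) (d : G.Walk b b) : Prop :=
  IsBicycle M c p d ∧
  wIn w M c.edges + 2 * wIn w M p.edges + wIn w M d.edges <
    wOut w M c.edges + 2 * wOut w M p.edges + wOut w M d.edges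

/-- All edges of the walk are tight with respect to the fractional vertex cover `y`. -/
def IsTightWalk (w : Sym2 V → ℝ) (y : V → ℝ) {a b : V} (p : G.Walk a b) : Prop :=
  ∀ d ∈ p.darts, y d.toProd.1 + y d.toProd.2 = w s(d.toProd.1, d.toProd.2)

/-- `x'` is the result of alternate rounding on the odd cycle with edge set `C`
at the vertex `u`: on `C` it is 0/1-valued, both edges of `C` at `u` get value 0,
and its 1-valued edges inside `C` perfectly match the remaining vertices of `C`. -/
def AltRoundedOn (x' : Sym2 V → ℝ) (C : Finset (Sym2 V)) (u : V) : Prop :=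
  (∀ e ∈ C, x' e = 0 ∨ x' e = 1) ∧ (∀ e ∈ C, u ∈ e → x' e = 0) ∧
  ∀ z ∈ edgeVerts C, z ≠ u → ∃! e : Sym2 V, e ∈ C ∧ x' e = 1 ∧ z ∈ e


set_option linter.unusedSectionVars false

section Duality

theorem sum_sum_sym2_eq_two_mul (z : Sym2 V → ℝ) (hz : ∀ v, z s(v, v) = 0) :
    ∑ v, ∑ u, z s(v, u) = 2 * ∑ e, z e := by
  rw [← Fintype.sum_prod_type', ← Finset.sum_fiberwise (g := fun p : V × V => s(p.1, p.2)),
    Finset.mul_sum]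
  refine Finset.sum_congr rfl fun e _ => ?_
  induction e using Sym2.ind with
  | _ a b =>
  have hconst : ∀ p ∈ Finset.univ.filter (fun p : V × V => s(p.1, p.2) = s(a, b)),
      z s(p.1, p.2) = z s(a, b) := fun p hp => by rw [(Finset.mem_filter.1 hp).2]
  rw [Finset.sum_congr rfl hconst]
  by_cases hab : a = b
  · subst hab
    simp [hz]
  · have hfib : Finset.univ.filter (fun p : V × V => s(p.1, p.2) = s(a, b))
        = {(a, b), (b, a)} := by
      ext ⟨c, d⟩
      simp
    rw [hfib, Finset.sum_pair (by simp [hab])]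
    ring

theorem two_mul_coverValue_sub_fracWeight (w x : Sym2 V → ℝ) (hx : ∀ v, x s(v, v) = 0)
    (y : V → ℝ) :
    2 * (coverValue y - fracWeight w x) =
      ∑ v, ∑ u, (y v + y u - w s(v, u)) * x s(v, u) + 2 * ∑ v, y v * (1 - ∑ u, x s(v, u)) := by
  have h := sum_sum_sym2_eq_two_mul (fun e => w e * x e) (by simp [hx])
  have hswap : ∑ v, ∑ u, y u * x s(v, u) = ∑ v, ∑ u, y v * x s(v, u) := by
    rw [Finset.sum_comm]
    simp_rw [Sym2.eq_swap]
  simp only [coverValue, fracWeight, mul_sub, ← h, sub_mul, add_mul, Finset.sum_sub_distrib,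
    Finset.sum_add_distrib, hswap, mul_one, Finset.mul_sum]
  simp only [← Finset.mul_sum]
  ring

theorem IsFracMatching.apply_diag {x : Sym2 V → ℝ} (hx : IsFracMatching G x) (v : V) :
    x s(v, v) = 0 := hx.2.1 _ (by simp)

theorem IsFracCover.slack_mul_nonneg {w x : Sym2 V → ℝ} {y : V → ℝ} (hy : IsFracCover G w y)
    (hx : IsFracMatching G x) (v u : V) : 0 ≤ (y v + y u - w s(v, u)) * x s(v, u) := by
  by_cases h : G.Adj v u
  · exact mul_nonneg (sub_nonneg.2 (hy.2 v u h)) (hx.1 _)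
  · rw [hx.2.1 s(v, u) h, mul_zero]

theorem IsFracCover.mul_exposed_nonneg {w x : Sym2 V → ℝ} {y : V → ℝ} (hy : IsFracCover G w y)
    (hx : IsFracMatching G x) (v : V) : 0 ≤ y v * (1 - ∑ u, x s(v, u)) :=
  mul_nonneg (hy.1 v) (sub_nonneg.2 (hx.2.2 v))

theorem IsFracMatching.fracWeight_le {w x : Sym2 V → ℝ} {y : V → ℝ} (hx : IsFracMatching G x)
    (hy : IsFracCover G w y) : fracWeight w x ≤ coverValue y := by
  have h := two_mul_coverValue_sub_fracWeight w x hx.apply_diag y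
  have h1 := Finset.sum_nonneg fun v (_ : v ∈ Finset.univ) =>
    Finset.sum_nonneg fun u (_ : u ∈ Finset.univ) => hy.slack_mul_nonneg hx v u
  have h2 := Finset.sum_nonneg fun v (_ : v ∈ Finset.univ) => hy.mul_exposed_nonneg hx v
  linarith

/-- Complementary slackness. -/
theorem IsFracMatching.fracWeight_eq_iff {w x : Sym2 V → ℝ} {y : V → ℝ}
    (hx : IsFracMatching G x) (hy : IsFracCover G w y) :
    fracWeight w x = coverValue y ↔
      (∀ v u, x s(v, u) ≠ 0 → y v + y u = w s(v, u)) ∧ ∀ v, y v ≠ 0 → ∑ u, x s(v, u) = 1 := by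
  have h := two_mul_coverValue_sub_fracWeight w x hx.apply_diag y
  have h1 : ∀ v ∈ Finset.univ, 0 ≤ ∑ u, (y v + y u - w s(v, u)) * x s(v, u) := fun v _ =>
    Finset.sum_nonneg fun u _ => hy.slack_mul_nonneg hx v u
  have h2 : ∀ v ∈ Finset.univ, 0 ≤ y v * (1 - ∑ u, x s(v, u)) := fun v _ =>
    hy.mul_exposed_nonneg hx v
  constructor
  · intro heq
    rw [heq, sub_self, mul_zero] at h
    have s1 := Finset.sum_nonneg h1
    have s2 := Finset.sum_nonneg h2
    have z1 := (Finset.sum_eq_zero_iff_of_nonneg h1).1 (by linarith)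
    have z2 := (Finset.sum_eq_zero_iff_of_nonneg h2).1 (by linarith)
    refine ⟨fun v u hvu => ?_, fun v hv => ?_⟩
    · have := (Finset.sum_eq_zero_iff_of_nonneg fun u _ => hy.slack_mul_nonneg hx v u).1
        (z1 v (Finset.mem_univ v)) u (Finset.mem_univ u)
      linarith [(mul_eq_zero.1 this).resolve_right hvu]
    · linarith [(mul_eq_zero.1 (z2 v (Finset.mem_univ v))).resolve_left hv]
  · rintro ⟨t, c⟩
    rw [Finset.sum_eq_zero fun v _ => Finset.sum_eq_zero fun u _ => ?_,
      Finset.sum_eq_zero fun v _ => ?_] at h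
    · linarith
    · by_cases hv : y v = 0
      · rw [hv, zero_mul]
      · rw [c v hv, sub_self, mul_zero]
    · by_cases hvu : x s(v, u) = 0
      · rw [hvu, mul_zero]
      · rw [t v u hvu, sub_self, zero_mul]

theorem exists_isMinFracCover (G : SimpleGraph V) (w : Sym2 V → ℝ) :
    ∃ y, IsMinFracCover G w y := by
  let B : ℝ := ∑ e, |w e|
  have hB : ∀ e, w e ≤ B := fun e => (le_abs_self _).trans
    (Finset.single_le_sum (f := fun e => |w e|) (fun _ _ => abs_nonneg _) (Finset.mem_univ e))
  have hB0 : 0 ≤ B := Finset.sum_nonneg fun _ _ => abs_nonneg _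
  have h0 : IsFracCover G w fun _ => B := ⟨fun _ => hB0, fun a b _ => by linarith [hB s(a, b)]⟩
  let K : Set (V → ℝ) := {y | IsFracCover G w y ∧ coverValue y ≤ coverValue fun _ : V => B}
  have hcont : Continuous (coverValue : (V → ℝ) → ℝ) := by
    unfold coverValue
    fun_prop
  have hclosed : IsClosed K := by
    have : K = ((⋂ v, {y | 0 ≤ y v}) ∩ ⋂ a, ⋂ b, ⋂ (_ : G.Adj a b), {y | w s(a, b) ≤ y a + y b})
        ∩ {y | coverValue y ≤ coverValue fun _ : V => B} := by
      ext y
      simp [K, IsFracCover]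
    rw [this]
    refine ((isClosed_iInter fun v => ?_).inter
      (isClosed_iInter fun a => isClosed_iInter fun b => isClosed_iInter fun _ => ?_)).inter ?_
    · exact isClosed_le continuous_const (continuous_apply v)
    · exact isClosed_le continuous_const (by fun_prop)
    · exact isClosed_le hcont continuous_const
  have hcomp : IsCompact K := by
    refine (isCompact_univ_pi fun _ : V => isCompact_Icc (a := (0 : ℝ))
      (b := coverValue fun _ : V => B)).of_isClosed_subset hclosed fun y hy v _ => ?_
    exact ⟨hy.1.1 v, (Finset.single_le_sum (fun u _ => hy.1.1 u) (Finset.mem_univ v)).trans hy.2⟩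
  obtain ⟨y, hy, hmin⟩ := hcomp.exists_isMinOn ⟨_, h0, le_rfl⟩ hcont.continuousOn
  refine ⟨y, hy.1, fun z hz => ?_⟩
  by_cases hzB : coverValue z ≤ coverValue fun _ : V => B
  · exact hmin ⟨hz, hzB⟩
  · exact hy.2.trans (not_le.1 hzB).le

theorem exists_pos_le_of_pos {ι : Type*} [Finite ι] (f : ι → ℝ) :
    ∃ δ > 0, ∀ i, 0 < f i → δ ≤ f i := by
  have : ∀ᶠ δ in nhdsWithin (0 : ℝ) (Set.Ioi 0), ∀ i, 0 < f i → δ ≤ f i := by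
    refine Filter.eventually_all.2 fun i => ?_
    by_cases hi : 0 < f i
    · filter_upwards [Ioc_mem_nhdsGT hi] with δ hδ _ using hδ.2
    · exact Filter.Eventually.of_forall fun _ h => absurd h hi
  obtain ⟨δ, h, hδ⟩ := (this.and self_mem_nhdsWithin).exists
  exact ⟨δ, hδ, h⟩

/-- `a` and `b` are joined by a tight edge, or `a = b` is a vertex with zero dual value. -/
def IsTightPair (G : SimpleGraph V) (w : Sym2 V → ℝ) (y : V → ℝ) (a b : V) : Prop :=
  (G.Adj a b ∧ y a + y b = w s(a, b)) ∨ (a = b ∧ y a = 0)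

theorem IsTightPair.symm {w : Sym2 V → ℝ} {y : V → ℝ} {a b : V} (h : IsTightPair G w y a b) :
    IsTightPair G w y b a := by
  rcases h with ⟨h1, h2⟩ | ⟨rfl, h⟩
  · exact Or.inl ⟨h1.symm, by rw [add_comm, h2, Sym2.eq_swap]⟩
  · exact Or.inr ⟨rfl, h⟩

open Classical in
theorem IsMinFracCover.exists_perm {w : Sym2 V → ℝ} {y : V → ℝ} (hy : IsMinFracCover G w y) :
    ∃ σ : Equiv.Perm V, ∀ v, IsTightPair G w y v (σ v) := by
  suffices ∃ f : V → V, Function.Injective f ∧ ∀ v, IsTightPair G w y v (f v) by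
    obtain ⟨f, hf, h⟩ := this
    exact ⟨Equiv.ofBijective f (Finite.injective_iff_bijective.1 hf), h⟩
  refine (Fintype.all_card_le_filter_rel_iff_exists_injective _).1 fun A => ?_
  by_contra! hA
  set B : Finset V := Finset.univ.filter fun b => ∃ a ∈ A, IsTightPair G w y a b
  have hAB : ∀ a b, IsTightPair G w y a b → a ∈ A → b ∈ B := fun a b h ha => by
    simpa [B] using ⟨a, ha, h⟩
  obtain ⟨δ, hδ, hslack⟩ := exists_pos_le_of_pos fun p : V × V => y p.1 + y p.2 - w s(p.1, p.2)
  obtain ⟨η, hη, hpos⟩ := exists_pos_le_of_pos y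
  set ε := min (δ / 2) η
  have hε : 0 < ε := lt_min (half_pos hδ) hη
  have hεδ : ε ≤ δ / 2 := min_le_left _ _
  have hεη : ε ≤ η := min_le_right _ _
  let z : V → ℝ := fun v => y v - (if v ∈ A then ε else 0) + if v ∈ B then ε else 0
  have hz : IsFracCover G w z := by
    constructor
    · intro v
      have hv : y v = 0 → v ∈ A → v ∈ B := fun h => hAB v v (Or.inr ⟨rfl, h⟩)
      have hv' := hpos v
      rcases (hy.1.1 v).eq_or_lt with h | h
      · have := hv h.symm
        simp only [z]
        split_ifs <;> first | linarith | tauto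
      · have := hv' h
        simp only [z]
        split_ifs <;> linarith
    · intro a b hab
      rcases (hy.1.2 a b hab).eq_or_lt with h | h
      · have ha := hAB a b (Or.inl ⟨hab, h.symm⟩)
        have hb := hAB b a (IsTightPair.symm (Or.inl ⟨hab, h.symm⟩))
        simp only [z]
        split_ifs <;> first | linarith | tauto
      · have := hslack (a, b) (sub_pos.2 h)
        simp only at this
        simp only [z]
        split_ifs <;> linarith
  have hle := hy.2 z hz
  have : coverValue z = coverValue y - A.card * ε + B.card * ε := by
    simp [coverValue, z, Finset.sum_add_distrib, Finset.sum_sub_distrib, Finset.sum_ite_mem]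
  have hcard : (B.card : ℝ) < A.card := by exact_mod_cast hA
  nlinarith

end Duality

section Permutations

open Classical in
theorem exists_perm_periods_odd_or_two (T : V → V → Prop) (hT : ∀ a b, T a b → T b a)
    (h : ∃ σ : Equiv.Perm V, ∀ v, T v (σ v)) :
    ∃ σ : Equiv.Perm V, (∀ v, T v (σ v)) ∧ ∀ a, σ (σ a) = a ∨ ∃ n, Odd n ∧ σ^[n] a = a := by
  obtain ⟨σ, hσ, hmin⟩ := Finset.exists_min_image
    (Finset.univ.filter fun σ : Equiv.Perm V => ∀ v, T v (σ v))
    (fun σ => (Finset.univ.filter fun v => σ (σ v) ≠ v).card)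
    (by obtain ⟨σ, hσ⟩ := h; exact ⟨σ, by simpa using hσ⟩)
  simp only [Finset.mem_filter, Finset.mem_univ, true_and] at hσ hmin
  refine ⟨σ, hσ, fun a => or_iff_not_imp_left.2 fun ha => ?_⟩
  by_contra! hodd
  have hodd' : ∀ i : ℤ, Odd i → (σ ^ i) a ≠ a := by
    intro i hi hia
    refine hodd i.natAbs (Int.natAbs_odd.2 hi) ?_
    rw [Equiv.Perm.iterate_eq_pow, ← zpow_natCast]
    rcases Int.natAbs_eq i with h | h
    · rwa [← h]
    · rw [h, zpow_neg, Equiv.Perm.inv_eq_iff_eq] at hia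
      exact hia.symm
  let E : Set V := {v | ∃ k : ℤ, v = (σ ^ (2 * k)) a}
  let E' : Set V := {v | ∃ k : ℤ, v = (σ ^ (2 * k + 1)) a}
  have hdisj : ∀ v, v ∈ E → v ∉ E' := by
    rintro v ⟨k, rfl⟩ ⟨l, hl⟩
    refine hodd' (2 * (l - k) + 1) ⟨_, rfl⟩ ?_
    rw [show 2 * (l - k) + 1 = -(2 * k) + (2 * l + 1) by ring, zpow_add, Equiv.Perm.mul_apply,
      ← hl, zpow_neg]
    simp
  have hE : ∀ v, σ v ∈ E' ↔ v ∈ E := fun v => exists_congr fun k => by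
    rw [add_comm, zpow_add, zpow_one, Equiv.Perm.mul_apply, σ.apply_eq_iff_eq]
  have hE' : ∀ v, σ v ∈ E ↔ v ∈ E' := by
    intro v
    constructor
    · rintro ⟨k, hk⟩
      refine ⟨k - 1, σ.injective ?_⟩
      rw [hk, ← Equiv.Perm.mul_apply, ← zpow_one_add]
      congr 2
      ring
    · rintro ⟨k, rfl⟩
      refine ⟨k + 1, ?_⟩
      rw [← Equiv.Perm.mul_apply, ← zpow_one_add]
      congr 2
      ring
  have hs : ∀ v, v ∈ E' → σ.symm v ∈ E := fun v hv => (hE _).1 (by simpa using hv)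
  let f : V → V := fun v => if v ∈ E' then σ.symm v else σ v
  have hf1 : ∀ v, v ∈ E' → f v = σ.symm v := fun v hv => if_pos hv
  have hf2 : ∀ v, v ∉ E' → f v = σ v := fun v hv => if_neg hv
  have hff : ∀ v, v ∈ E ∨ v ∈ E' → f (f v) = v := by
    rintro v (hv | hv)
    · rw [hf2 v (hdisj v hv), hf1 _ ((hE v).2 hv), Equiv.symm_apply_apply]
    · rw [hf1 v hv, hf2 _ (hdisj _ (hs v hv)), Equiv.apply_symm_apply]
  have hf : Function.Injective f := by
    intro u v huv
    by_cases hu : u ∈ E' <;> by_cases hv : v ∈ E'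
    · rw [hf1 u hu, hf1 v hv] at huv
      exact σ.symm.injective huv
    · rw [hf1 u hu, hf2 v hv] at huv
      have := hs u hu
      rw [huv, hE'] at this
      exact absurd this hv
    · rw [hf2 u hu, hf1 v hv] at huv
      have := hs v hv
      rw [← huv, hE'] at this
      exact absurd this hu
    · rw [hf2 u hu, hf2 v hv] at huv
      exact σ.injective huv
  let τ : Equiv.Perm V := Equiv.ofBijective f (Finite.injective_iff_bijective.1 hf)
  have hτ : ∀ v, T v (τ v) := by
    intro v
    change T v (f v)
    by_cases hv : v ∈ E'
    · rw [hf1 v hv]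
      apply hT
      simpa using hσ (σ.symm v)
    · rw [hf2 v hv]
      exact hσ v
  refine (hmin τ hτ).not_gt (Finset.card_lt_card ?_)
  have haE : a ∈ E := ⟨0, by simp⟩
  refine (Finset.ssubset_iff_of_subset fun v hv => ?_).2
    ⟨a, by simpa using ha, by simpa [τ] using hff a (Or.inl haE)⟩
  simp only [Finset.mem_filter, Finset.mem_univ, true_and] at hv ⊢
  change f (f v) ≠ v at hv
  have hv' := mt (hff v) hv
  push Not at hv'
  rwa [hf2 v hv'.2, hf2 _ (mt (hE v).1 hv'.1)] at hv

/-- The half-integral fractional matching of a permutation. -/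
noncomputable def permFrac (σ : Equiv.Perm V) : Sym2 V → ℝ :=
  Sym2.lift ⟨fun a b => if a = b then 0 else
    ((if σ a = b then 1 else 0) + if σ b = a then 1 else 0) / 2, fun a b => by
      simp only [eq_comm (a := a) (b := b), add_comm]⟩

theorem permFrac_mk (σ : Equiv.Perm V) (a b : V) : permFrac σ s(a, b) =
    if a = b then 0 else ((if σ a = b then 1 else 0) + if σ b = a then 1 else 0) / 2 := rfl

theorem permFrac_ne_zero {σ : Equiv.Perm V} {a b : V} (h : permFrac σ s(a, b) ≠ 0) :
    a ≠ b ∧ (σ a = b ∨ σ b = a) := by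
  rw [permFrac_mk] at h
  split_ifs at h <;> simp_all

theorem isHalfIntegral_permFrac (σ : Equiv.Perm V) : IsHalfIntegral (permFrac σ) := by
  intro e
  induction e using Sym2.ind with
  | _ a b =>
  rw [permFrac_mk]
  split_ifs <;> norm_num

theorem permFrac_eq_half_iff {σ : Equiv.Perm V} {a b : V} : permFrac σ s(a, b) = 1 / 2 ↔
    (σ a = b ∧ σ b ≠ a) ∨ (σ b = a ∧ σ a ≠ b) := by
  rw [permFrac_mk]
  split_ifs with h1 h2 h3 h3
  · subst h1
    norm_num
  all_goals norm_num [*]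

theorem sum_permFrac (σ : Equiv.Perm V) (v : V) :
    ∑ u, permFrac σ s(v, u) = if σ v = v then 0 else 1 := by
  split_ifs with h
  · refine Finset.sum_eq_zero fun u _ => by_contra fun hu => ?_
    obtain ⟨h1, h2 | h2⟩ := permFrac_ne_zero hu
    · exact h1 (h.symm.trans h2)
    · exact h1 (σ.injective (h.trans h2.symm))
  · have : ∀ u, permFrac σ s(v, u) =
        ((if σ v = u then 1 else 0) + if u = σ.symm v then 1 else 0) / 2 := by
      intro u
      rw [permFrac_mk]
      simp only [Equiv.eq_symm_apply]
      split_ifs <;> simp_all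
    simp only [this, ← Finset.sum_div, Finset.sum_add_distrib, Finset.sum_ite_eq,
      Finset.sum_ite_eq', Finset.mem_univ, if_true]
    norm_num

theorem isFracMatching_permFrac {σ : Equiv.Perm V} (h : ∀ v, σ v ≠ v → G.Adj v (σ v)) :
    IsFracMatching G (permFrac σ) := by
  refine ⟨fun e => ?_, fun e he => ?_, fun v => ?_⟩
  · rcases isHalfIntegral_permFrac σ e with h | h | h <;> rw [h] <;> norm_num
  · induction e using Sym2.ind with
    | _ a b =>
    by_contra hab
    obtain ⟨hne, rfl | rfl⟩ := permFrac_ne_zero hab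
    · exact he (h a hne.symm)
    · exact he (h b hne).symm
  · rw [sum_permFrac]
    split_ifs <;> norm_num

theorem isFracMatching_permFrac_of_tight {w : Sym2 V → ℝ} {y : V → ℝ} {σ : Equiv.Perm V}
    (h : ∀ v, IsTightPair G w y v (σ v)) : IsFracMatching G (permFrac σ) :=
  isFracMatching_permFrac fun v hv => ((h v).resolve_right fun h => hv h.1.symm).1

theorem fracWeight_permFrac {w : Sym2 V → ℝ} {y : V → ℝ} (hy : IsFracCover G w y)
    {σ : Equiv.Perm V} (h : ∀ v, IsTightPair G w y v (σ v)) :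
    fracWeight w (permFrac σ) = coverValue y := by
  have htight : ∀ v, σ v ≠ v → y v + y (σ v) = w s(v, σ v) := fun v hv =>
    ((h v).resolve_right fun h => hv h.1.symm).2
  refine ((isFracMatching_permFrac_of_tight h).fracWeight_eq_iff hy).2
    ⟨fun v u hvu => ?_, fun v hv => ?_⟩
  · obtain ⟨hne, rfl | rfl⟩ := permFrac_ne_zero hvu
    · exact htight v hne.symm
    · rw [add_comm, Sym2.eq_swap]
      exact htight u hne
  · rw [sum_permFrac, if_neg fun hfix => hv ?_]
    exact ((h v).resolve_left fun h => h.1.ne hfix.symm).2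

theorem isMaxFracMatching_permFrac {w : Sym2 V → ℝ} {y : V → ℝ} (hy : IsFracCover G w y)
    {σ : Equiv.Perm V} (h : ∀ v, IsTightPair G w y v (σ v)) :
    IsMaxFracMatching G w (permFrac σ) :=
  ⟨isFracMatching_permFrac_of_tight h, fun _ hz =>
    (hz.fracWeight_le hy).trans_eq (fracWeight_permFrac hy h).symm⟩

/-- The edges `s(u, σ u)` along the cycle of `σ` through `v`. -/
def cycleEdges (σ : Equiv.Perm V) (v : V) : Finset (Sym2 V) :=
  (Finset.univ.filter fun u => σ.SameCycle v u).image fun u => s(u, σ u)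

theorem mem_cycleEdges {σ : Equiv.Perm V} {v : V} {e : Sym2 V} :
    e ∈ cycleEdges σ v ↔ ∃ u, σ.SameCycle v u ∧ s(u, σ u) = e := by
  simp [cycleEdges]

theorem cycleEdges_eq {σ : Equiv.Perm V} {u v : V} (h : σ.SameCycle u v) :
    cycleEdges σ u = cycleEdges σ v := by
  ext e
  simp only [mem_cycleEdges]
  exact exists_congr fun a => and_congr_left fun _ => ⟨h.symm.trans, h.trans⟩

theorem mem_edgeVerts_cycleEdges {σ : Equiv.Perm V} {v a : V}
    (h : a ∈ edgeVerts (cycleEdges σ v)) : σ.SameCycle v a := by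
  obtain ⟨e, he, ha⟩ := h
  obtain ⟨u, hu, rfl⟩ := mem_cycleEdges.1 he
  rcases Sym2.mem_iff.1 ha with rfl | rfl
  · exact hu
  · exact Equiv.Perm.sameCycle_apply_right.2 hu

theorem exists_walk_iterate (f : V → V) (n : ℕ) (a : V)
    (h : ∀ i, G.Adj (f^[i] a) (f^[i + 1] a)) (b : V) (hb : f^[n] a = b) :
    ∃ p : G.Walk a b, p.support = (List.range (n + 1)).map (fun i => f^[i] a) ∧
      p.edges = (List.range n).map fun i => s(f^[i] a, f^[i + 1] a) := by
  induction n generalizing b with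
  | zero =>
    subst hb
    exact ⟨.nil, by simp, by simp⟩
  | succ n ih =>
    subst hb
    obtain ⟨p, hs, he⟩ := ih _ rfl
    refine ⟨p.concat (h n), ?_, ?_⟩
    · rw [SimpleGraph.Walk.support_concat, hs, List.range_succ (n := n + 1)]
      simp
    · rw [SimpleGraph.Walk.edges_concat, he, List.range_succ (n := n)]
      simp

theorem isOddCycleEdgeSet_cycleEdges {σ : Equiv.Perm V} (h : ∀ v, σ v ≠ v → G.Adj v (σ v))
    {v : V} (hv : σ (σ v) ≠ v) {n : ℕ} (hn : Odd n) (hnv : σ^[n] v = v) :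
    IsOddCycleEdgeSet G (cycleEdges σ v) := by
  have hv1 : σ v ≠ v := fun h => hv (by rw [h, h])
  have hadj : ∀ i, G.Adj (σ^[i] v) (σ^[i + 1] v) := by
    intro i
    rw [Function.iterate_succ_apply']
    refine h _ ?_
    rw [← Function.iterate_succ_apply' (f := σ), Function.iterate_succ_apply]
    exact fun h => hv1 (σ.injective.iterate i h)
  have hper : Function.IsPeriodicPt σ n v := hnv
  have hodd : Odd (Function.minimalPeriod σ v) := hn.of_dvd_nat hper.minimalPeriod_dvd
  have hinj := Function.iterate_injOn_Iio_minimalPeriod (f := σ) (x := v)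
  have hend := Function.iterate_minimalPeriod (f := σ) (x := v)
  have hmod : ∀ i, σ^[i % Function.minimalPeriod σ v] v = σ^[i] v := fun i =>
    Function.iterate_mod_minimalPeriod_eq
  generalize Function.minimalPeriod σ v = N at *
  obtain ⟨m, rfl⟩ : ∃ m, N = m + 1 := ⟨N - 1, by have := hodd.pos; omega⟩
  have hm : m ≠ 0 := by
    rintro rfl
    exact hv1 hend
  obtain ⟨p, hs, he⟩ := exists_walk_iterate σ m (σ v) (fun i => hadj (i + 1)) v hend
  have hlen : p.length = m := by rw [← SimpleGraph.Walk.length_edges, he]; simp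
  refine ⟨v, .cons (h v hv1) p, (SimpleGraph.Walk.cons_isCycle_iff _ _).2 ⟨?_, ?_⟩, ?_, ?_⟩
  · rw [SimpleGraph.Walk.isPath_def, hs]
    refine List.Nodup.map_on (fun i hi j hj hij => ?_) List.nodup_range
    rw [← Function.iterate_succ_apply, ← Function.iterate_succ_apply,
      Function.iterate_succ_apply', Function.iterate_succ_apply'] at hij
    exact hinj (List.mem_range.1 hi) (List.mem_range.1 hj) (σ.injective hij)
  · rw [he, List.mem_map]
    rintro ⟨i, hi, hie⟩
    rw [List.mem_range] at hi
    rw [← Function.iterate_succ_apply, ← Function.iterate_succ_apply] at hie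
    rcases Sym2.eq_iff.1 hie with ⟨h1, _⟩ | ⟨h1, h2⟩
    · have := hinj (Set.mem_Iio.2 (Nat.succ_lt_succ hi)) (Set.mem_Iio.2 m.succ_pos) h1
      omega
    · rw [Function.iterate_succ_apply' (f := σ), h1] at h2
      exact hv h2
  · simpa [hlen] using hodd
  · ext e
    rw [SimpleGraph.Walk.edges_cons, he, mem_cycleEdges]
    have key : (∃ u, σ.SameCycle v u ∧ s(u, σ u) = e) ↔
        ∃ i < m + 1, s(σ^[i] v, σ^[i + 1] v) = e := by
      constructor
      · rintro ⟨u, hu, rfl⟩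
        obtain ⟨i, rfl⟩ := hu.exists_nat_pow_eq
        refine ⟨i % (m + 1), Nat.mod_lt _ (by omega), ?_⟩
        rw [Function.iterate_succ_apply' (f := σ), hmod, Equiv.Perm.iterate_eq_pow]
      · rintro ⟨i, _, rfl⟩
        exact ⟨_, ⟨i, by rw [zpow_natCast, ← Equiv.Perm.iterate_eq_pow]⟩, by
          rw [Function.iterate_succ_apply']⟩
    rw [key]
    simp only [List.mem_toFinset, List.mem_cons, List.mem_map, List.mem_range]
    constructor
    · rintro (rfl | ⟨i, hi, rfl⟩)
      · exact ⟨0, by omega, rfl⟩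
      · exact ⟨i + 1, by omega, rfl⟩
    · rintro ⟨_ | i, hi, rfl⟩
      · exact Or.inl rfl
      · exact Or.inr ⟨i, by omega, rfl⟩

/-- The edge sets of the cycles of `σ` of length at least three. -/
def longCycles (σ : Equiv.Perm V) : Finset (Finset (Sym2 V)) :=
  (Finset.univ.filter fun v => σ (σ v) ≠ v).image (cycleEdges σ)

theorem mem_longCycles {σ : Equiv.Perm V} {C : Finset (Sym2 V)} :
    C ∈ longCycles σ ↔ ∃ v, σ (σ v) ≠ v ∧ cycleEdges σ v = C := by
  simp [longCycles]

theorem isCycleFamily_longCycles {σ : Equiv.Perm V} (h : ∀ v, σ v ≠ v → G.Adj v (σ v))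
    (hodd : ∀ a, σ (σ a) = a ∨ ∃ n, Odd n ∧ σ^[n] a = a) :
    IsCycleFamily G (permFrac σ) (longCycles σ) := by
  refine ⟨fun C hC => ?_, fun C hC D hD hne => ?_, fun e => ?_⟩
  · obtain ⟨v, hv, rfl⟩ := mem_longCycles.1 hC
    obtain ⟨n, hn, hnv⟩ := (hodd v).resolve_left hv
    exact isOddCycleEdgeSet_cycleEdges h hv hn hnv
  · obtain ⟨u, hu, rfl⟩ := mem_longCycles.1 hC
    obtain ⟨v, hv, rfl⟩ := mem_longCycles.1 hD
    refine Set.disjoint_left.2 fun a ha hb => hne ?_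
    exact cycleEdges_eq ((mem_edgeVerts_cycleEdges ha).trans (mem_edgeVerts_cycleEdges hb).symm)
  · constructor
    · induction e using Sym2.ind with
      | _ a b =>
      rw [permFrac_eq_half_iff]
      rintro (⟨rfl, hb⟩ | ⟨rfl, ha⟩)
      · exact ⟨_, mem_longCycles.2 ⟨a, hb, rfl⟩, mem_cycleEdges.2 ⟨a, .rfl, rfl⟩⟩
      · exact ⟨_, mem_longCycles.2 ⟨b, ha, rfl⟩, mem_cycleEdges.2 ⟨b, .rfl, Sym2.eq_swap⟩⟩
    · rintro ⟨C, hC, he⟩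
      obtain ⟨v, hv, rfl⟩ := mem_longCycles.1 hC
      obtain ⟨u, ⟨i, rfl⟩, rfl⟩ := mem_cycleEdges.1 he
      refine permFrac_eq_half_iff.2 (Or.inl ⟨rfl, fun h => hv ?_⟩)
      have hcomm : σ ^ i * (σ * σ) = σ * (σ * σ ^ i) := by group
      have : (σ ^ i) (σ (σ v)) = (σ ^ i) v := (Equiv.ext_iff.1 hcomm v).trans h
      exact (σ ^ i).injective this

end Permutations

section Counting

theorem IsMatching.eq_of_mem {M : Finset (Sym2 V)} (hM : IsMatching G M) {v a b : V}
    (ha : s(v, a) ∈ M) (hb : s(v, b) ∈ M) : a = b := by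
  by_contra hne
  exact hM.2 _ ha _ hb (fun h => hne (Sym2.congr_right.1 h)) v (by simp) (by simp)

/-- A permutation that is tight for a cover `y` of the perturbed weights `w - ε` off `M` has at
most `S.card` long cycles, provided `y'` is a cover of `G∖S` that is tight on the matching `M`. -/
theorem card_longCycles_le {w : Sym2 V → ℝ} {S : Finset V} {M : Finset (Sym2 V)}
    (hM : IsMatching (deleteVerts G ↑S) M) {y y' : V → ℝ} {ε : ℝ} (hε : 0 < ε)
    (hy' : IsFracCover (deleteVerts G ↑S) w y')
    (htight : ∀ a b, s(a, b) ∈ M → y' a + y' b = w s(a, b))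
    (hcov : ∀ v, y' v ≠ 0 → ∃ u, s(v, u) ∈ M)
    (hy : IsFracCover G (fun e => w e - if e ∈ M then 0 else ε) y) {σ : Equiv.Perm V}
    (hσ : ∀ v, IsTightPair G (fun e => w e - if e ∈ M then 0 else ε) y v (σ v))
    (hodd : ∀ a, σ (σ a) = a ∨ ∃ n, Odd n ∧ σ^[n] a = a) :
    (longCycles σ).card ≤ S.card := by
  classical
  set d : V → ℝ := fun v => y v - y' v with hd
  set P : Finset V := Finset.univ.filter fun v => v ∉ S ∧ 0 < d v
  set N : Finset V := Finset.univ.filter fun v => v ∉ S ∧ d v < 0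
  have hP : ∀ v, v ∈ P ↔ v ∉ S ∧ 0 < d v := by simp [P]
  have hN : ∀ v, v ∈ N ↔ v ∉ S ∧ d v < 0 := by simp [N]
  have hMS : ∀ {a b}, s(a, b) ∈ M → G.Adj a b ∧ a ∉ S ∧ b ∉ S := fun h => hM.1 h
  have hedge : ∀ a b, IsTightPair G (fun e => w e - if e ∈ M then 0 else ε) y a b → a ≠ b →
      a ∉ S → b ∉ S → d a + d b ≤ -(if s(a, b) ∈ M then 0 else ε) := by
    intro a b hab hne ha hb
    obtain ⟨h1, h2⟩ := hab.resolve_right fun h => hne h.1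
    have := hy'.2 a b ⟨h1, ha, hb⟩
    simp only [hd]
    linarith
  have hmatched : ∀ a b, s(a, b) ∈ M → 0 ≤ d a + d b := by
    intro a b hab
    have h1 := hy.2 a b (hMS hab).1
    simp only [if_pos hab] at h1
    have h2 := htight a b hab
    simp only [hd]
    linarith
  have hPN : ∀ a b, IsTightPair G (fun e => w e - if e ∈ M then 0 else ε) y a b →
      a ∈ P → b ∈ N ∪ S := by
    intro a b hab ha
    rw [hP] at ha
    have hne : a ≠ b := by
      rintro rfl
      have h0 : y a = 0 := (hab.resolve_left fun h => h.1.ne rfl).2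
      have := hy'.1 a
      have := ha.2
      simp only [hd] at this
      linarith
    by_cases hb : b ∈ S
    · exact Finset.mem_union_right _ hb
    · have h1 := hedge a b hab hne ha.1 hb
      have h2 : 0 ≤ if s(a, b) ∈ M then 0 else ε := by split_ifs <;> linarith
      exact Finset.mem_union_left _ ((hN b).2 ⟨hb, by linarith [ha.2]⟩)
  have hdisj : ∀ a, a ∈ P → a ∉ N ∪ S := by
    intro a ha h
    rw [hP] at ha
    rcases Finset.mem_union.1 h with h | h
    · exact absurd ((hN a).1 h).2 ha.2.not_gt
    · exact ha.1 h
  have hNP : N.card ≤ P.card := by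
    have hpartner : ∀ v : V, ∃ u, v ∈ N → s(v, u) ∈ M := by
      intro v
      by_cases hv : v ∈ N
      · have h1 : y' v ≠ 0 := fun h0 => by
          have h2 := ((hN v).1 hv).2
          have := hy.1 v
          simp only [hd] at h2
          linarith
        obtain ⟨u, hu⟩ := hcov v h1
        exact ⟨u, fun _ => hu⟩
      · exact ⟨v, fun h => absurd h hv⟩
    choose f hf using hpartner
    refine Finset.card_le_card_of_injOn f (fun v hv => ?_) fun a ha b hb hab => ?_
    · have h1 := hmatched _ _ (hf v hv)
      have h2 := ((hN v).1 hv).2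
      exact (hP _).2 ⟨(hMS (hf v hv)).2.2, by linarith⟩
    · have h1 := hf a ha
      have h2 := hf b hb
      rw [hab] at h1
      rw [Sym2.eq_swap] at h1 h2
      exact hM.eq_of_mem h1 h2
  have hsub : longCycles σ ⊆ ((N ∪ S) \ P.image σ).image (cycleEdges σ) := by
    intro C hC
    obtain ⟨v, hv, rfl⟩ := mem_longCycles.1 hC
    suffices ∃ a, σ.SameCycle v a ∧ a ∈ N ∪ S ∧ σ.symm a ∉ P by
      obtain ⟨a, hva, ha, haP⟩ := this
      refine Finset.mem_image.2 ⟨a, Finset.mem_sdiff.2 ⟨ha, fun h => haP ?_⟩,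
        (cycleEdges_eq hva).symm⟩
      obtain ⟨b, hb, rfl⟩ := Finset.mem_image.1 h
      rwa [Equiv.symm_apply_apply]
    by_contra! hall
    obtain ⟨n, hn, hnv⟩ := (hodd v).resolve_left hv
    have hstart : ∃ a, σ.SameCycle v a ∧ a ∈ N ∪ S := by
      by_contra! hnone
      have hS : ∀ a, σ.SameCycle v a → a ∉ S ∧ 0 ≤ d a := fun a ha => by
        have h1 := hnone a ha
        rw [Finset.mem_union, not_or, hN] at h1
        exact ⟨h1.2, not_lt.1 fun h => h1.1 ⟨h1.2, h⟩⟩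
      have hmem : ∀ a, σ.SameCycle v a → a ≠ σ a → s(a, σ a) ∈ M := by
        intro a ha hne
        have h1 := hS a ha
        have h2 := hS (σ a) (Equiv.Perm.sameCycle_apply_right.2 ha)
        by_contra hnot
        have h3 := hedge a (σ a) (hσ a) hne h1.1 h2.1
        rw [if_neg hnot] at h3
        linarith [h1.2, h2.2]
      have hv1 : v ≠ σ v := fun h => hv (by rw [← h, ← h])
      have h1 := hmem v .rfl hv1
      have h2 := hmem (σ v) (Equiv.Perm.sameCycle_apply_right.2 .rfl)
        fun h => hv1 (σ.injective h)
      rw [Sym2.eq_swap] at h1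
      exact hv (hM.eq_of_mem h2 h1)
    obtain ⟨a, hva, ha⟩ := hstart
    have hsame : ∀ k, σ.SameCycle v (σ.symm^[k] a) := by
      intro k
      induction k with
      | zero => exact hva
      | succ k ih =>
        rw [Function.iterate_succ_apply']
        exact Equiv.Perm.sameCycle_symm_apply_right.2 ih
    have halt : ∀ k, σ.symm^[2 * k] a ∈ N ∪ S := by
      intro k
      induction k with
      | zero => exact ha
      | succ k ih =>
        have hprev : σ.symm^[2 * k + 1] a ∈ P := by
          rw [Function.iterate_succ_apply']
          exact hall _ (hsame _) ih
        rw [show 2 * (k + 1) = (2 * k + 1) + 1 by ring, Function.iterate_succ_apply']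
        refine hPN _ _ (IsTightPair.symm ?_) hprev
        simpa using hσ (σ.symm (σ.symm^[2 * k + 1] a))
    have hna : σ^[n] a = a := by
      obtain ⟨i, rfl⟩ := hva
      rw [Equiv.Perm.iterate_eq_pow] at hnv ⊢
      rw [← Equiv.Perm.mul_apply, ((Commute.refl σ).pow_left n).zpow_right i |>.eq,
        Equiv.Perm.mul_apply, hnv]
    have hna' : σ.symm^[n] a = a := by
      conv_lhs => rw [← hna]
      exact (Function.LeftInverse.iterate σ.symm_apply_apply n) a
    obtain ⟨k, rfl⟩ := hn
    have h1 := hall _ (hsame (2 * k)) (halt k)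
    rw [← Function.iterate_succ_apply' (f := σ.symm), Nat.succ_eq_add_one, hna'] at h1
    exact hdisj a h1 ha
  have himage : P.image σ ⊆ N ∪ S := fun b hb => by
    obtain ⟨a, ha, rfl⟩ := Finset.mem_image.1 hb
    exact hPN a _ (hσ a) ha
  have h1 := (Finset.card_le_card hsub).trans Finset.card_image_le
  rw [Finset.card_sdiff_of_subset himage, Finset.card_image_of_injective _ σ.injective] at h1
  have h2 := Finset.card_union_le N S
  omega

end Counting

section Stable

theorem exists_matching_setWeight_eq_nu (G : SimpleGraph V) (w : Sym2 V → ℝ) :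
    ∃ M, IsMatching G M ∧ setWeight w M = nu G w := by
  have hfin : {r : ℝ | ∃ M : Finset (Sym2 V), IsMatching G M ∧ r = setWeight w M}.Finite :=
    (Set.finite_range (setWeight w)).subset fun r ⟨M, _, hr⟩ => ⟨M, hr.symm⟩
  have hne : {r : ℝ | ∃ M : Finset (Sym2 V), IsMatching G M ∧ r = setWeight w M}.Nonempty :=
    ⟨_, ∅, ⟨by simp, by simp⟩, rfl⟩
  obtain ⟨M, hM, h⟩ := hne.csSup_mem hfin
  exact ⟨M, hM, h.symm⟩

theorem exists_cover_tight_perm (G : SimpleGraph V) (w : Sym2 V → ℝ) :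
    ∃ y, IsFracCover G w y ∧ ∃ σ : Equiv.Perm V, (∀ v, IsTightPair G w y v (σ v)) ∧
      ∀ a, σ (σ a) = a ∨ ∃ n, Odd n ∧ σ^[n] a = a := by
  obtain ⟨y, hy⟩ := exists_isMinFracCover G w
  exact ⟨y, hy.1, exists_perm_periods_odd_or_two _ (fun _ _ => IsTightPair.symm) hy.exists_perm⟩

theorem IsFracCover.nuf_eq {w : Sym2 V → ℝ} {y : V → ℝ} (hy : IsFracCover G w y)
    {x : Sym2 V → ℝ} (hx : IsFracMatching G x) (h : fracWeight w x = coverValue y) :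
    nuf G w = coverValue y :=
  IsGreatest.csSup_eq ⟨⟨x, hx, h.symm⟩, by
    rintro r ⟨z, hz, rfl⟩
    exact hz.fracWeight_le hy⟩

theorem IsMatching.sum_indicator {M : Finset (Sym2 V)} (hM : IsMatching G M) (v : V) :
    ∑ u, (if s(v, u) ∈ M then (1 : ℝ) else 0) = if ∃ u, s(v, u) ∈ M then 1 else 0 := by
  split_ifs with h
  · obtain ⟨u, hu⟩ := h
    rw [Finset.sum_eq_single u fun b _ hb => if_neg fun hbM => hb (hM.eq_of_mem hbM hu), if_pos hu]
    exact fun h => absurd (Finset.mem_univ u) h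
  · exact Finset.sum_eq_zero fun u _ => if_neg fun hu => h ⟨u, hu⟩

theorem IsMatching.isFracMatching {M : Finset (Sym2 V)} (hM : IsMatching G M) :
    IsFracMatching G fun e => if e ∈ M then 1 else 0 := by
  refine ⟨fun e => by positivity, fun e he => if_neg fun h => he (hM.1 h), fun v => ?_⟩
  rw [hM.sum_indicator]
  split_ifs <;> norm_num

/-- A stable graph has a matching and a fractional cover in complementary slackness. -/
theorem IsStable.exists_matching_cover {w : Sym2 V → ℝ} (h : IsStable G w) :
    ∃ M y, IsMatching G M ∧ IsFracCover G w y ∧ (∀ a b, s(a, b) ∈ M → y a + y b = w s(a, b)) ∧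
      ∀ v, y v ≠ 0 → ∃ u, s(v, u) ∈ M := by
  obtain ⟨M, hM, hMw⟩ := exists_matching_setWeight_eq_nu G w
  obtain ⟨y, hy, σ, hσ, -⟩ := exists_cover_tight_perm G w
  have heq : fracWeight w (fun e => if e ∈ M then 1 else 0) = coverValue y := by
    rw [← hy.nuf_eq (isFracMatching_permFrac_of_tight hσ) (fracWeight_permFrac hy hσ), ← h, ← hMw]
    simp [fracWeight, setWeight]
  obtain ⟨h1, h2⟩ := (hM.isFracMatching.fracWeight_eq_iff hy).1 heq
  refine ⟨M, y, hM, hy, fun a b hab => h1 a b (by simp [hab]), fun v hv => ?_⟩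
  by_contra hne
  have := h2 v hv
  rw [hM.sum_indicator, if_neg hne] at this
  norm_num at this

end Stable

/-- every vertex-stabilizer `S` of `G` satisfies |S| ≥ γ(G). -/
theorem vertexStabilizer_lower_bound
    {V : Type*} [Fintype V] [DecidableEq V]
    (G : SimpleGraph V) (w : Sym2 V → ℝ) (hw : ∀ e, 0 ≤ w e)
    (S : Finset V) (hS : IsStable (deleteVerts G ↑S) w) :
    gamma G w ≤ S.card := by
  obtain ⟨M, y', hM, hy', htight, hcov⟩ := hS.exists_matching_cover
  choose y hy σ hσ hodd using fun n : ℕ =>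
    exists_cover_tight_perm G fun e => w e - if e ∈ M then 0 else 1 / ((n : ℝ) + 1)
  obtain ⟨τ, hτ⟩ := Finite.exists_infinite_fiber σ
  have hinf : (σ ⁻¹' {τ}).Infinite := Set.infinite_coe_iff.1 hτ
  obtain ⟨n₀, hn₀⟩ := hinf.nonempty
  have hn₀ : σ n₀ = τ := hn₀
  have hadj : ∀ v, τ v ≠ v → G.Adj v (τ v) := fun v hv =>
    ((hn₀ ▸ hσ n₀ v).resolve_right fun h => hv h.1.symm).1
  have hcard : (longCycles τ).card ≤ S.card := hn₀ ▸
    card_longCycles_le hM Nat.one_div_pos_of_nat hy' htight hcov (hy n₀) (hσ n₀) (hodd n₀)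
  have hsplit : ∀ (n : ℕ) (x : Sym2 V → ℝ),
      fracWeight (fun e => w e - if e ∈ M then 0 else 1 / ((n : ℝ) + 1)) x =
        fracWeight w x - 1 / ((n : ℝ) + 1) * ∑ e, if e ∈ M then 0 else x e := by
    intro n x
    simp only [fracWeight, Finset.mul_sum, ← Finset.sum_sub_distrib]
    refine Finset.sum_congr rfl fun e _ => ?_
    split_ifs <;> ring
  have hmax : IsMaxFracMatching G w (permFrac τ) := by
    refine ⟨isFracMatching_permFrac hadj, fun z hz => le_of_forall_pos_le_add fun δ hδ => ?_⟩
    set c : ℝ := (∑ e, if e ∈ M then 0 else z e) - ∑ e, if e ∈ M then 0 else permFrac τ e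
    obtain ⟨k, hk⟩ := exists_nat_gt (c / δ)
    obtain ⟨n, hn, hkn⟩ := hinf.exists_gt k
    have hn : σ n = τ := hn
    have h := (isMaxFracMatching_permFrac (hy n) (hσ n)).2 z hz
    rw [hn, hsplit, hsplit] at h
    have hle : 1 / ((n : ℝ) + 1) * c ≤ δ := by
      have hkn' : (k : ℝ) < n := by exact_mod_cast hkn
      rw [div_lt_iff₀ hδ] at hk
      rw [one_div_mul_eq_div, div_le_iff₀ (by positivity)]
      nlinarith
    simp only [c] at hle
    linarith
  have hgamma : gamma G w ≤ (longCycles τ).card := Nat.sInf_le ⟨_, _, hmax,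
    isHalfIntegral_permFrac τ, isCycleFamily_longCycles hadj (hn₀ ▸ hodd n₀), rfl⟩
  exact hgamma.trans hcard

end Stabilizer
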